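/- If Γ is a shifted simplicial complex on vertex set [n] (i.e., for every face F, if j < i and i ∈ F then (F \ {i}) ∪ {j} is also a face), and G is a face of Γ with |G| = r, G ∩ [i-r+1] = ∅, G ∪ [i-r] ∈ Γ but G ∪ [i-r+1] ∉ Γ, then G ∪ [i-r] is a facet (maximal face) of Γ of cardinality i. -/

import Mathlib

/-- A simplicial complex on vertex set `[n] = {1,...,n}`: a collection of finite
subsets of `{1,...,n}` closed under taking subsets. -/
def IsComplex (n : ℕ) (Γ : Set (Finset ℕ)) : Prop :=
  (∀ F ∈ Γ, F ⊆ Finset.Icc 1 n) ∧ ∀ F ∈ Γ, ∀ G ⊆ F, G ∈ Γ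

/-- `Γ` is shifted: replacing a vertex `i` of a face by any smaller vertex `j ≥ 1`
yields a face. -/
def IsShifted (Γ : Set (Finset ℕ)) : Prop :=
  ∀ F ∈ Γ, ∀ i ∈ F, ∀ j : ℕ, 1 ≤ j → j < i → insert j (F.erase i) ∈ Γ

/-- A facet is a maximal face. -/
def IsFacet (Γ : Set (Finset ℕ)) (F : Finset ℕ) : Prop :=
  F ∈ Γ ∧ ∀ G ∈ Γ, F ⊆ G → F = G

theorem shifted_union_initial_segment_is_facet
    (n i r : ℕ) (Γ : Set (Finset ℕ)) (hc : IsComplex n Γ) (hs : IsShifted Γ)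
    (hr : r ≤ i) (G : Finset ℕ) (hG : G ∈ Γ) (hcard : G.card = r)
    (hdisj : G ∩ Finset.Icc 1 (i - r + 1) = ∅)
    (h1 : G ∪ Finset.Icc 1 (i - r) ∈ Γ)
    (h2 : G ∪ Finset.Icc 1 (i - r + 1) ∉ Γ) :
    IsFacet Γ (G ∪ Finset.Icc 1 (i - r)) ∧ (G ∪ Finset.Icc 1 (i - r)).card = i := by
  set k := i - r with hk
  have hmem : ∀ y ∈ G, ¬ (1 ≤ y ∧ y ≤ k + 1) := by
    intro y hy hyk
    have : y ∈ G ∩ Finset.Icc 1 (k + 1) := by simp [hy, hyk]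
    simp [hdisj] at this
  refine ⟨⟨h1, fun H hH hsub => ?_⟩, ?_⟩
  · refine hsub.antisymm fun x hx => ?_
    by_contra hxF
    have hx1 : 1 ≤ x := (Finset.mem_Icc.mp (hc.1 H hH hx)).1
    obtain ⟨hxG, hxk⟩ : x ∉ G ∧ k < x := by
      simpa [hx1] using hxF
    have hsub' : ∀ y, y ∈ G ∨ (1 ≤ y ∧ y ≤ k) → y ∈ H := by
      intro y hy
      exact hsub (by simpa using hy)
    rcases (Nat.succ_le_of_lt hxk).eq_or_lt with hxe | hlt
    · refine h2 (hc.2 H hH _ fun y hy => ?_)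
      simp only [Finset.mem_union, Finset.mem_Icc] at hy
      grind
    · refine h2 (hc.2 _ (hs H hH x hx (k + 1) (by omega) hlt) _ fun y hy => ?_)
      simp only [Finset.mem_union, Finset.mem_Icc] at hy
      simp only [Finset.mem_insert, Finset.mem_erase]
      grind
  · rw [Finset.card_union_of_disjoint, Nat.card_Icc, hcard]
    · omega
    · rw [Finset.disjoint_left]
      intro y hy hyk
      rw [Finset.mem_Icc] at hyk
      exact hmem y hy ⟨hyk.1, by omega⟩
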